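/- arXiv:1606.02044 — 2 statements merged into one kernel-verified Lean document; each statement's English description precedes it below -/
import Mathlib

section
/- For every integer m ≥ 1, the Stieltjes constant γ_m satisfies γ_m = −Σ_{n=0}^∞ C_{n+1} Σ_{k=0}^n (−1)^k C(n,k) (ln(k+2))^m/(k+2), the outer series being convergent, where C_n are the normalized Cauchy numbers of the second kind. -/
open Filter Finset intervalIntegral

/-- The normalized Cauchy numbers of the second kind
`C_n = ∫₀¹ x(x+1)(x+2)⋯(x+n−1)/n! dx`. -/
noncomputable def cauchyC (n : ℕ) : ℝ :=
  ∫ x in (0:ℝ)..1, (∏ i ∈ Finset.range n, (x + (i : ℝ))) / (n.factorial : ℝ)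

lemma prod_add_div_factorial_eq_choose (x : ℝ) (n : ℕ) :
    (∏ i ∈ Finset.range n, (x + (i : ℝ))) / (n.factorial : ℝ) = Ring.choose (x + n - 1) n := by
  have h1 : ∀ n : ℕ, (ascPochhammer ℕ n).smeval x = ∏ i ∈ Finset.range n, (x + (i : ℝ)) := by
    intro n
    induction n with
    | zero => simp
    | succ n ih =>
      rw [ascPochhammer_succ_right, Polynomial.smeval_mul, ih, Finset.prod_range_succ]
      simp [Polynomial.smeval_add, Polynomial.smeval_X, Polynomial.smeval_natCast]
  have h2 := Ring.factorial_nsmul_multichoose_eq_ascPochhammer x n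
  rw [h1, nsmul_eq_mul] at h2
  rw [Ring.choose, ← h2, mul_div_cancel_left₀ _ (by positivity)]
  congr 1
  ring

lemma hasSum_prod_add_div_factorial_mul_pow (x : ℝ) {y : ℝ} (hy : |y| < 1) :
    HasSum (fun n : ℕ => (∏ i ∈ Finset.range n, (x + (i : ℝ))) / (n.factorial : ℝ) * y ^ n)
      (1 / (1 - y) ^ x) := by
  have h := (Real.one_div_one_sub_rpow_hasFPowerSeriesOnBall_zero x).hasSum (y := y)
    (by simpa [enorm_eq_nnnorm, ← NNReal.coe_lt_coe] using hy)
  simpa [FormalMultilinearSeries.ofScalars_apply_eq, mul_comm,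
    prod_add_div_factorial_eq_choose] using h

lemma prod_add_div_factorial_nonneg {x : ℝ} (hx : 0 ≤ x) (n : ℕ) :
    0 ≤ (∏ i ∈ Finset.range n, (x + (i : ℝ))) / (n.factorial : ℝ) := by
  positivity

lemma prod_add_div_factorial_le_one {x : ℝ} (hx : 0 ≤ x) (hx1 : x ≤ 1) (n : ℕ) :
    (∏ i ∈ Finset.range n, (x + (i : ℝ))) / (n.factorial : ℝ) ≤ 1 := by
  rw [div_le_one (by positivity), ← Finset.prod_range_add_one_eq_factorial]
  push_cast
  refine Finset.prod_le_prod (fun i _ => by positivity) fun i _ => by linarith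

lemma continuous_prod_add_div_factorial (n : ℕ) :
    Continuous fun x : ℝ => (∏ i ∈ Finset.range n, (x + (i : ℝ))) / (n.factorial : ℝ) := by
  fun_prop

lemma cauchyC_nonneg (n : ℕ) : 0 ≤ cauchyC n :=
  intervalIntegral.integral_nonneg zero_le_one fun _ hx => prod_add_div_factorial_nonneg hx.1 n

lemma cauchyC_le_one (n : ℕ) : cauchyC n ≤ 1 := by
  have h : cauchyC n ≤ ∫ _ in (0:ℝ)..1, (1 : ℝ) :=
    intervalIntegral.integral_mono_on zero_le_one
      ((continuous_prod_add_div_factorial n).intervalIntegrable _ _)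
      (continuous_const.intervalIntegrable _ _)
      fun x hx => prod_add_div_factorial_le_one hx.1 hx.2 n
  simpa using h

lemma cauchyC_zero : cauchyC 0 = 1 := by simp [cauchyC]

lemma hasSum_cauchyC_mul_pow {y : ℝ} (hy : |y| < 1) :
    HasSum (fun n : ℕ => cauchyC n * y ^ n) (∫ x in (0:ℝ)..1, 1 / (1 - y) ^ x) := by
  have h := intervalIntegral.hasSum_integral_of_dominated_convergence (a := 0) (b := 1)
    (μ := MeasureTheory.volume)
    (F := fun (n : ℕ) (x : ℝ) =>
      (∏ i ∈ Finset.range n, (x + (i : ℝ))) / (n.factorial : ℝ) * y ^ n)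
    (f := fun x => 1 / (1 - y) ^ x) (fun n _ => |y| ^ n)
    (fun n => ((continuous_prod_add_div_factorial n).mul
      continuous_const).aestronglyMeasurable)
    (fun n => .of_forall fun x hx => by
      rw [Set.uIoc_of_le zero_le_one] at hx
      rw [norm_mul, norm_pow, Real.norm_of_nonneg (prod_add_div_factorial_nonneg hx.1.le n)]
      exact mul_le_of_le_one_left (by positivity) (prod_add_div_factorial_le_one hx.1.le hx.2 n))
    (.of_forall fun _ _ => summable_geometric_of_lt_one (abs_nonneg y) hy)
    (continuous_const.intervalIntegrable _ _)
    (.of_forall fun x _ => hasSum_prod_add_div_factorial_mul_pow x hy)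
  simpa [cauchyC, intervalIntegral.integral_mul_const] using h

lemma one_sub_exp_neg_mem_Ioo {t : ℝ} (ht : 0 < t) : 1 - Real.exp (-t) ∈ Set.Ioo (0 : ℝ) 1 := by
  have h : Real.exp (-t) < 1 := Real.exp_lt_one_iff.2 (by linarith)
  exact ⟨by linarith, by linarith [Real.exp_pos (-t)]⟩

lemma hasSum_cauchyC_succ_mul_pow {t : ℝ} (ht : 0 < t) :
    HasSum (fun n : ℕ => cauchyC (n + 1) * (1 - Real.exp (-t)) ^ n)
      (Real.exp t / t - 1 / (1 - Real.exp (-t))) := by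
  obtain ⟨h0, h1⟩ := one_sub_exp_neg_mem_Ioo ht
  have h := hasSum_cauchyC_mul_pow (y := 1 - Real.exp (-t)) (by rwa [abs_of_pos h0])
  have hint : ∫ x in (0:ℝ)..1, 1 / (1 - (1 - Real.exp (-t))) ^ x = (Real.exp t - 1) / t := by
    have : ∀ x : ℝ, 1 / (1 - (1 - Real.exp (-t))) ^ x = Real.exp (t * x) := by
      intro x
      rw [sub_sub_cancel, ← Real.exp_mul, one_div, ← Real.exp_neg]
      ring_nf
    simp_rw [this]
    rw [intervalIntegral.integral_comp_mul_left (fun x => Real.exp x) ht.ne', integral_exp]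
    simp [div_eq_inv_mul]
  rw [hint, ← hasSum_nat_add_iff' 1] at h
  have hterm : (fun n : ℕ => cauchyC (n + 1) * (1 - Real.exp (-t)) ^ n) =
      fun n : ℕ => cauchyC (n + 1) * (1 - Real.exp (-t)) ^ (n + 1) / (1 - Real.exp (-t)) := by
    ext n
    rw [pow_succ]
    field_simp
  have hsum : Real.exp t / t - 1 / (1 - Real.exp (-t)) = ((Real.exp t - 1) / t -
      ∑ i ∈ range 1, cauchyC i * (1 - Real.exp (-t)) ^ i) / (1 - Real.exp (-t)) := by
    have h2 : Real.exp t * Real.exp (-t) = 1 := by rw [← Real.exp_add]; simp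
    simp only [sum_range_one, cauchyC_zero, pow_zero, mul_one]
    field_simp
    linear_combination -h2
  rw [hterm, hsum]
  exact h.div_const _

/-- The kernel `e^{-2t} (1 - e^{-t})^n`, whose Mellin transform is `Γ(s)` times the `n`-th
alternating binomial sum of `(k + 2)^{-s}`. -/
noncomputable def expKernel (n : ℕ) (t : ℝ) : ℝ := Real.exp (-2 * t) * (1 - Real.exp (-t)) ^ n

/-- The sum `Σ_{k=0}^n (-1)^k C(n,k) (k+2)^{-s}`. -/
noncomputable def binomialDirichletSum (n : ℕ) (s : ℂ) : ℂ :=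
  ∑ k ∈ Finset.range (n + 1), (-1) ^ k * (n.choose k : ℂ) *
    Complex.exp (-(Real.log ((k : ℝ) + 2) : ℂ) * s)

lemma natCast_add_two_cpow (k : ℕ) (s : ℂ) :
    (((k : ℝ) + 2 : ℝ) : ℂ) ^ s = Complex.exp ((Real.log ((k : ℝ) + 2) : ℂ) * s) := by
  rw [Complex.cpow_def_of_ne_zero, Complex.ofReal_log (by positivity)]
  exact_mod_cast (by positivity : (k : ℝ) + 2 ≠ 0)

lemma expKernel_eq_sum (n : ℕ) (t : ℝ) :
    expKernel n t =
      ∑ k ∈ Finset.range (n + 1), (-1) ^ k * (n.choose k : ℝ) * Real.exp (-((k : ℝ) + 2) * t) := by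
  rw [expKernel, sub_eq_neg_add, add_pow, Finset.mul_sum]
  refine Finset.sum_congr rfl fun k _ => ?_
  rw [show -((k : ℝ) + 2) * t = -2 * t + k * (-t) by ring, Real.exp_add, Real.exp_nat_mul,
    neg_pow]
  ring

lemma mellin_expKernel (n : ℕ) {s : ℂ} (hs : 0 < s.re) :
    mellin (fun t => (expKernel n t : ℂ)) s = Complex.Gamma s * binomialDirichletSum n s := by
  have hzero : ∀ k ∉ Finset.range (n + 1), ((-1) ^ k * (n.choose k : ℂ)) = 0 := by
    intro k hk
    rw [Nat.choose_eq_zero_of_lt (by simpa [Nat.lt_succ_iff] using hk)]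
    simp
  have h := hasSum_mellin (a := fun k : ℕ => (-1) ^ k * (n.choose k : ℂ))
    (p := fun k : ℕ => (k : ℝ) + 2) (F := fun t => (expKernel n t : ℂ)) (s := s)
    (fun k => .inr (by positivity)) hs
    (fun t _ => by
      rw [expKernel_eq_sum]
      push_cast
      refine (hasSum_sum_of_ne_finset_zero (s := Finset.range (n + 1)) ?_)
      intro k hk
      rw [hzero k hk, zero_mul])
    (summable_of_ne_finset_zero (s := Finset.range (n + 1)) fun k hk => by
      rw [hzero k hk]; simp)
  rw [← h.tsum_eq, tsum_eq_sum (s := Finset.range (n + 1)) fun k hk => by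
    rw [hzero k hk]; simp, binomialDirichletSum, Finset.mul_sum]
  refine Finset.sum_congr rfl fun k _ => ?_
  rw [natCast_add_two_cpow, neg_mul, Complex.exp_neg]
  ring

lemma expKernel_nonneg (n : ℕ) {t : ℝ} (ht : 0 < t) : 0 ≤ expKernel n t :=
  mul_nonneg (Real.exp_pos _).le (pow_nonneg (one_sub_exp_neg_mem_Ioo ht).1.le _)

lemma hasSum_expKernel {t : ℝ} (ht : 0 < t) :
    HasSum (fun n => expKernel n t) (Real.exp (-t)) := by
  obtain ⟨h0, h1⟩ := one_sub_exp_neg_mem_Ioo ht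
  have h := (hasSum_geometric_of_lt_one h0.le h1).mul_left (Real.exp (-2 * t))
  rw [sub_sub_cancel, ← Real.exp_neg, ← Real.exp_add] at h
  rwa [show -2 * t + - -t = -t by ring] at h

lemma continuous_expKernel (n : ℕ) : Continuous (expKernel n) := by
  unfold expKernel
  fun_prop

lemma integrableOn_rpow_mul_exp_neg {a : ℝ} (ha : 0 < a) :
    MeasureTheory.IntegrableOn (fun t : ℝ => t ^ (a - 1) * Real.exp (-t)) (Set.Ioi 0) := by
  simpa only [mul_comm] using Real.GammaIntegral_convergent ha

lemma hasSum_integral_rpow_mul_expKernel {a : ℝ} (ha : 0 < a) :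
    HasSum (fun n => ∫ t in Set.Ioi (0 : ℝ), t ^ (a - 1) * expKernel n t)
      (∫ t in Set.Ioi (0 : ℝ), t ^ (a - 1) * Real.exp (-t)) := by
  have hsum : ∀ᵐ t ∂MeasureTheory.volume.restrict (Set.Ioi (0 : ℝ)),
      HasSum (fun n => t ^ (a - 1) * expKernel n t) (t ^ (a - 1) * Real.exp (-t)) :=
    (MeasureTheory.ae_restrict_mem measurableSet_Ioi).mono
      fun t ht => (hasSum_expKernel ht).mul_left _
  refine MeasureTheory.hasSum_integral_of_dominated_convergence
    (fun n t => t ^ (a - 1) * expKernel n t) (fun n => ?_) (fun n => ?_)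
    (hsum.mono fun t h => h.summable) ?_ hsum
  · have := continuous_expKernel n
    exact (by fun_prop : Measurable fun t : ℝ => t ^ (a - 1) * expKernel n t).aestronglyMeasurable
  · filter_upwards [MeasureTheory.ae_restrict_mem measurableSet_Ioi] with t ht
    exact (Real.norm_of_nonneg (mul_nonneg (Real.rpow_nonneg (le_of_lt ht) _)
      (expKernel_nonneg n ht))).le
  · exact (integrableOn_rpow_mul_exp_neg ha).congr (hsum.mono fun t h => h.tsum_eq.symm)

lemma integrableOn_rpow_mul_expKernel {a : ℝ} (ha : 0 < a) (n : ℕ) :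
    MeasureTheory.IntegrableOn (fun t : ℝ => t ^ (a - 1) * expKernel n t) (Set.Ioi 0) := by
  refine MeasureTheory.Integrable.mono' (integrableOn_rpow_mul_exp_neg ha) ?_ ?_
  · have := continuous_expKernel n
    exact (by fun_prop : Measurable fun t : ℝ => t ^ (a - 1) * expKernel n t).aestronglyMeasurable
  · filter_upwards [MeasureTheory.ae_restrict_mem measurableSet_Ioi] with t ht
    have ht' : 0 < t := ht
    rw [Real.norm_of_nonneg (mul_nonneg (Real.rpow_nonneg ht'.le _) (expKernel_nonneg n ht))]
    gcongr
    exact le_hasSum (hasSum_expKernel ht) n fun m _ => expKernel_nonneg m ht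

lemma norm_mellin_expKernel_le {a b : ℝ} (ha : 0 < a) (n : ℕ) {s : ℂ} (has : a ≤ s.re)
    (hsb : s.re ≤ b) :
    ‖mellin (fun t => (expKernel n t : ℂ)) s‖ ≤
      (∫ t in Set.Ioi (0 : ℝ), t ^ (a - 1) * expKernel n t) +
        ∫ t in Set.Ioi (0 : ℝ), t ^ (b - 1) * expKernel n t := by
  have hia := integrableOn_rpow_mul_expKernel ha n
  have hib := integrableOn_rpow_mul_expKernel (ha.trans_le (has.trans hsb)) n
  rw [← MeasureTheory.integral_add hia hib]
  refine MeasureTheory.norm_integral_le_of_norm_le (hia.add hib) ?_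
  filter_upwards [MeasureTheory.ae_restrict_mem measurableSet_Ioi] with t ht
  have ht' : 0 < t := ht
  have hw := expKernel_nonneg n ht
  rw [norm_smul, Complex.norm_cpow_eq_rpow_re_of_pos ht, Complex.norm_real,
    Real.norm_of_nonneg hw, Complex.sub_re, Complex.one_re]
  simp only [← add_mul]
  refine mul_le_mul_of_nonneg_right ?_ hw
  have h1 := Real.rpow_nonneg ht'.le (a - 1)
  have h2 := Real.rpow_nonneg ht'.le (b - 1)
  rcases le_total t 1 with h | h
  · have := Real.rpow_le_rpow_of_exponent_ge ht' h (by linarith : a - 1 ≤ s.re - 1)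
    linarith
  · have := Real.rpow_le_rpow_of_exponent_le h (by linarith : s.re - 1 ≤ b - 1)
    linarith

lemma hasSum_cauchyC_mul_mellin_expKernel {s : ℂ} (hs : 0 < s.re) :
    HasSum (fun n => (cauchyC (n + 1) : ℂ) * mellin (fun t => (expKernel n t : ℂ)) s)
      (mellin (fun t => ((Real.exp (-t) / t -
        Real.exp (-2 * t) / (1 - Real.exp (-t)) : ℝ) : ℂ)) s) := by
  simp_rw [mellin, ← MeasureTheory.integral_const_mul]
  refine MeasureTheory.hasSum_integral_of_dominated_convergence
    (fun n t => t ^ (s.re - 1) * expKernel n t) (fun n => ?_) (fun n => ?_) ?_ ?_ ?_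
  · have := continuous_expKernel n
    simp only [smul_eq_mul]
    exact (by fun_prop : Measurable fun t : ℝ =>
      (cauchyC (n + 1) : ℂ) * ((t : ℂ) ^ (s - 1) * (expKernel n t : ℂ))).aestronglyMeasurable
  · filter_upwards [MeasureTheory.ae_restrict_mem measurableSet_Ioi] with t ht
    rw [norm_mul, norm_smul, Complex.norm_cpow_eq_rpow_re_of_pos ht, Complex.norm_real,
      Complex.norm_real, Real.norm_of_nonneg (expKernel_nonneg n ht), Complex.sub_re,
      Complex.one_re, Real.norm_of_nonneg (cauchyC_nonneg _)]
    exact mul_le_of_le_one_left (mul_nonneg (Real.rpow_nonneg (le_of_lt ht) _)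
      (expKernel_nonneg n ht)) (cauchyC_le_one _)
  · filter_upwards [MeasureTheory.ae_restrict_mem measurableSet_Ioi] with t ht
    exact ((hasSum_expKernel ht).mul_left _).summable
  · refine (integrableOn_rpow_mul_exp_neg hs).congr ?_
    filter_upwards [MeasureTheory.ae_restrict_mem measurableSet_Ioi] with t ht
    exact ((hasSum_expKernel ht).mul_left _).tsum_eq.symm
  · filter_upwards [MeasureTheory.ae_restrict_mem measurableSet_Ioi] with t ht
    have h := ((hasSum_cauchyC_succ_mul_pow ht).mul_left (Real.exp (-2 * t)))
    have h' := (Complex.hasSum_ofReal.2 h).mul_left ((t : ℂ) ^ (s - 1))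
    have hlim : Real.exp (-t) / t - Real.exp (-2 * t) / (1 - Real.exp (-t)) =
        Real.exp (-2 * t) * (Real.exp t / t - 1 / (1 - Real.exp (-t))) := by
      have : Real.exp (-t) = Real.exp (-2 * t) * Real.exp t := by
        rw [← Real.exp_add]; ring_nf
      rw [mul_sub, ← mul_div_assoc, ← this, mul_one_div]
    have hterm : (fun n : ℕ => (cauchyC (n + 1) : ℂ) *
        ((t : ℂ) ^ (s - 1) • (expKernel n t : ℂ))) = fun n : ℕ => (t : ℂ) ^ (s - 1) *
          ((Real.exp (-2 * t) * (cauchyC (n + 1) * (1 - Real.exp (-t)) ^ n) : ℝ) : ℂ) := by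
      ext n
      simp only [expKernel, smul_eq_mul]
      push_cast
      ring
    rw [hterm, smul_eq_mul, hlim]
    exact h'

lemma mellin_exp_neg_div {s : ℂ} (hs : 1 < s.re) :
    HasMellin (fun t => ((Real.exp (-t) / t : ℝ) : ℂ)) s (Complex.Gamma (s - 1)) := by
  have hs' : 0 < (s - 1).re := by simpa using hs
  have heq : Set.EqOn (fun t : ℝ => ((Real.exp (-t) : ℝ) : ℂ) * (t : ℂ) ^ (s - 1 - 1))
      (fun t : ℝ => (t : ℂ) ^ (s - 1) • ((Real.exp (-t) / t : ℝ) : ℂ)) (Set.Ioi 0) := by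
    intro t ht
    have ht' : (t : ℂ) ≠ 0 := by exact_mod_cast (ne_of_gt ht)
    simp only [smul_eq_mul, Complex.ofReal_div]
    rw [Complex.cpow_sub _ 1 ht', Complex.cpow_one]
    ring
  refine ⟨?_, ?_⟩
  · refine (Complex.GammaIntegral_convergent hs').congr_fun (fun t ht => ?_) measurableSet_Ioi
    exact heq ht
  · rw [Complex.Gamma_eq_integral hs', mellin, Complex.GammaIntegral]
    exact (MeasureTheory.setIntegral_congr_fun measurableSet_Ioi heq).symm

lemma mellinConvergent_exp_neg_two_mul_div {s : ℂ} (hs : 1 < s.re) :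
    MellinConvergent (fun t => ((Real.exp (-2 * t) / (1 - Real.exp (-t)) : ℝ) : ℂ)) s := by
  refine MeasureTheory.Integrable.mono (mellin_exp_neg_div hs).1 ?_ ?_
  · exact (by fun_prop : Measurable fun t : ℝ => (t : ℂ) ^ (s - 1) •
      ((Real.exp (-2 * t) / (1 - Real.exp (-t)) : ℝ) : ℂ)).aestronglyMeasurable
  · filter_upwards [MeasureTheory.ae_restrict_mem measurableSet_Ioi] with t ht
    have ht' : 0 < t := ht
    have h0 := (one_sub_exp_neg_mem_Ioo ht').1
    rw [norm_smul, norm_smul, Complex.norm_real, Complex.norm_real,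
      Real.norm_of_nonneg (by positivity), Real.norm_of_nonneg (by positivity)]
    refine mul_le_mul_of_nonneg_left ?_ (norm_nonneg _)
    rw [div_le_div_iff₀ h0 ht']
    have h1 : Real.exp (-2 * t) = Real.exp (-t) * Real.exp (-t) := by
      rw [← Real.exp_add]; ring_nf
    have h2 : Real.exp (-t) * Real.exp t = 1 := by rw [← Real.exp_add]; simp
    have h3 := mul_le_mul_of_nonneg_left (Real.add_one_le_exp t) (Real.exp_pos (-t)).le
    rw [h1, mul_assoc]
    exact mul_le_mul_of_nonneg_left (by linarith) (Real.exp_pos _).le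

lemma mellin_exp_neg_two_mul_div {s : ℂ} (hs : 1 < s.re) :
    mellin (fun t => ((Real.exp (-2 * t) / (1 - Real.exp (-t)) : ℝ) : ℂ)) s =
      Complex.Gamma s * (riemannZeta s - 1) := by
  have hsummable : Summable fun k : ℕ => 1 / ((k : ℝ) + 2) ^ s.re := by
    have := (summable_nat_add_iff 2).2 (Real.summable_one_div_nat_rpow.2 hs)
    exact_mod_cast this
  have h := hasSum_mellin (a := fun _ : ℕ => 1) (p := fun k : ℕ => (k : ℝ) + 2)
    (F := fun t => ((Real.exp (-2 * t) / (1 - Real.exp (-t)) : ℝ) : ℂ)) (s := s)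
    (fun k => .inr (by positivity)) (by linarith)
    (fun t ht => by
      have h0 : Real.exp (-t) < 1 := Real.exp_lt_one_iff.2 (neg_lt_zero.2 ht)
      have hg := Complex.hasSum_ofReal.2
        ((hasSum_geometric_of_lt_one (Real.exp_pos _).le h0).mul_left (Real.exp (-2 * t)))
      convert hg using 1
      · ext k
        rw [one_mul, ← Real.exp_nat_mul, ← Real.exp_add]
        ring_nf
      · rw [div_eq_mul_inv])
    (by simpa using hsummable)
  have hz : HasSum (fun k : ℕ => 1 / (((k : ℝ) + 2 : ℝ) : ℂ) ^ s) (riemannZeta s - 1) := by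
    have hs1 : Summable fun n : ℕ => 1 / ((n : ℂ) + 1) ^ s := by
      have := (summable_nat_add_iff 1).2 (Complex.summable_one_div_nat_cpow.2 hs)
      exact_mod_cast this
    have h1 := hs1.hasSum
    rw [← zeta_eq_tsum_one_div_nat_add_one_cpow hs, ← hasSum_nat_add_iff' 1] at h1
    have hterm : (fun k : ℕ => 1 / (((k : ℝ) + 2 : ℝ) : ℂ) ^ s) =
        fun k : ℕ => 1 / (((k + 1 : ℕ) : ℂ) + 1) ^ s := by
      ext k
      push_cast
      rw [add_assoc, one_add_one_eq_two]
    have hsum : riemannZeta s - 1 =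
        riemannZeta s - ∑ i ∈ range 1, 1 / ((i : ℂ) + 1) ^ s := by simp
    rw [hterm, hsum]
    exact h1
  rw [← h.tsum_eq, ← (hz.mul_left (Complex.Gamma s)).tsum_eq]
  exact tsum_congr fun k => by ring

lemma hasSum_cauchyC_mul_binomialDirichletSum {s : ℂ} (hs : 1 < s.re) :
    HasSum (fun n => (cauchyC (n + 1) : ℂ) * binomialDirichletSum n s)
      (1 - (riemannZeta s - 1 / (s - 1))) := by
  have hs0 : 0 < s.re := by linarith
  have hne : s - 1 ≠ 0 := by
    intro h
    have := congrArg Complex.re h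
    simp at this
    linarith
  have hG : Complex.Gamma s ≠ 0 := Complex.Gamma_ne_zero_of_re_pos hs0
  have hG1 : Complex.Gamma s = (s - 1) * Complex.Gamma (s - 1) := by
    simpa using Complex.Gamma_add_one (s - 1) hne
  have h1 := hasMellin_sub (mellin_exp_neg_div hs).1 (mellinConvergent_exp_neg_two_mul_div hs)
  have h2 := hasSum_cauchyC_mul_mellin_expKernel hs0
  simp only [Complex.ofReal_sub] at h2
  rw [h1.2, (mellin_exp_neg_div hs).2, mellin_exp_neg_two_mul_div hs] at h2
  have h3 := h2.div_const (Complex.Gamma s)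
  have hterm : (fun n : ℕ => (cauchyC (n + 1) : ℂ) * binomialDirichletSum n s) = fun n : ℕ =>
      (cauchyC (n + 1) : ℂ) * mellin (fun t => (expKernel n t : ℂ)) s / Complex.Gamma s := by
    ext n
    rw [mellin_expKernel n hs0]
    field_simp
  have hsum : 1 - (riemannZeta s - 1 / (s - 1)) = (Complex.Gamma (s - 1) -
      Complex.Gamma s * (riemannZeta s - 1)) / Complex.Gamma s := by
    rw [sub_div, mul_div_cancel_left₀ _ hG, hG1]
    have : Complex.Gamma (s - 1) ≠ 0 := fun h => hG (by rw [hG1, h, mul_zero])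
    field_simp
    ring
  rw [hterm, hsum]
  exact h3

lemma contDiff_binomialDirichletSum (n : ℕ) {m : WithTop ℕ∞} :
    ContDiff ℂ m (binomialDirichletSum n) := by
  unfold binomialDirichletSum
  fun_prop

lemma iteratedDeriv_binomialDirichletSum_one (n m : ℕ) :
    iteratedDeriv m (binomialDirichletSum n) 1 = (-1) ^ m *
      ∑ k ∈ Finset.range (n + 1), (-1) ^ k * (n.choose k : ℂ) *
        (Complex.ofReal (Real.log ((k : ℝ) + 2))) ^ m / ((k : ℂ) + 2) := by
  unfold binomialDirichletSum
  rw [iteratedDeriv_fun_sum fun k _ => by fun_prop, Finset.mul_sum]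
  refine Finset.sum_congr rfl fun k _ => ?_
  have h : Complex.exp (Real.log ((k : ℝ) + 2) : ℂ) = (k : ℂ) + 2 := by
    simpa using (natCast_add_two_cpow k 1).symm
  rw [iteratedDeriv_const_mul_field, iteratedDeriv_cexp_const_mul]
  simp only [mul_one]
  rw [neg_pow, Complex.exp_neg, h]
  ring

lemma summable_norm_bound_binomialDirichletSum : ∃ u : ℕ → ℝ, Summable u ∧
    ∀ n, ∀ s ∈ Metric.ball (1 : ℂ) (1 / 2),
      ‖(cauchyC (n + 1) : ℂ) * binomialDirichletSum n s‖ ≤ u n := by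
  obtain ⟨B, hB⟩ := (isCompact_closedBall (1 : ℂ) (1 / 2)).exists_bound_of_continuousOn
    (f := fun s => (Complex.Gamma s)⁻¹) Complex.differentiable_one_div_Gamma.continuous.continuousOn
  have hsum := (hasSum_integral_rpow_mul_expKernel (a := 1 / 2) (by norm_num)).summable.add
    (hasSum_integral_rpow_mul_expKernel (a := 3 / 2) (by norm_num)).summable
  refine ⟨_, hsum.mul_left B, fun n s hs => ?_⟩
  have hre : |s.re - 1| < 1 / 2 := by
    have := Complex.abs_re_le_norm (s - 1)
    rw [Complex.sub_re, Complex.one_re] at this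
    exact this.trans_lt (by simpa [dist_eq_norm] using hs)
  obtain ⟨h1, h2⟩ := abs_lt.1 hre
  have hs0 : 0 < s.re := by linarith
  have hbd := norm_mellin_expKernel_le (a := 1 / 2) (b := 3 / 2) (by norm_num) n
    (by linarith : 1 / 2 ≤ s.re) (by linarith)
  have heq : binomialDirichletSum n s =
      (Complex.Gamma s)⁻¹ * mellin (fun t => (expKernel n t : ℂ)) s := by
    rw [mellin_expKernel n hs0, inv_mul_cancel_left₀ (Complex.Gamma_ne_zero_of_re_pos hs0)]
  rw [norm_mul, Complex.norm_real, Real.norm_of_nonneg (cauchyC_nonneg _)]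
  refine (mul_le_of_le_one_left (norm_nonneg _) (cauchyC_le_one _)).trans ?_
  rw [heq, norm_mul]
  have hBs := hB s (Metric.ball_subset_closedBall hs)
  exact mul_le_mul hBs hbd (norm_nonneg _) ((norm_nonneg _).trans hBs)

lemma tendstoLocallyUniformlyOn_iteratedDeriv {F : ℕ → ℂ → ℂ} {f : ℂ → ℂ} {U : Set ℂ}
    (hU : IsOpen U) (hF : ∀ n, ContDiff ℂ ⊤ (F n))
    (h : TendstoLocallyUniformlyOn F f atTop U) (m : ℕ) :
    TendstoLocallyUniformlyOn (fun n => iteratedDeriv m (F n)) (iteratedDeriv m f) atTop U := by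
  induction m with
  | zero => simpa only [iteratedDeriv_zero] using h
  | succ m ih =>
    simp only [iteratedDeriv_succ]
    exact ih.deriv (.of_forall fun n => ((hF n).differentiable_iteratedDeriv m
      (WithTop.coe_lt_top _)).differentiableOn) hU

/-- Series for the Stieltjes constants with the normalized Cauchy numbers of the second kind:
if `g` is the entire function agreeing with `ζ(s) − 1/(s−1)` away from `1`, then for `m ≥ 1`
the `m`-th Stieltjes constant `γ_m = (−1)^m g^{(m)}(1)` satisfies
`γ_m = −Σ_{n=0}^∞ C_{n+1} Σ_{k=0}^n (−1)^k C(n,k) (ln(k+2))^m/(k+2)`,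
the outer series being convergent. -/
theorem stieltjes_cauchy_series (m : ℕ) (hm : 1 ≤ m) (g : ℂ → ℂ) (hg : Differentiable ℂ g)
    (hgz : ∀ s : ℂ, s ≠ 1 → g s = riemannZeta s - 1 / (s - 1)) :
    ∃ L : ℂ,
      Tendsto (fun N : ℕ => ∑ n ∈ Finset.range N, (Complex.ofReal (cauchyC (n + 1))) *
          ∑ k ∈ Finset.range (n + 1), (-1) ^ k * (n.choose k : ℂ) *
            (Complex.ofReal (Real.log ((k : ℝ) + 2))) ^ m / ((k : ℂ) + 2))
        atTop (nhds L) ∧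
      (-1) ^ m * iteratedDeriv m g 1 = -L := by
  set U : Set ℂ := Metric.ball 1 (1 / 2) with hUdef
  have hU : IsOpen U := Metric.isOpen_ball
  have h1U : (1 : ℂ) ∈ U := Metric.mem_ball_self (by norm_num)
  set f : ℂ → ℂ := fun s => ∑' n, (cauchyC (n + 1) : ℂ) * binomialDirichletSum n s with hfdef
  set F : ℕ → ℂ → ℂ := fun N s =>
    ∑ n ∈ Finset.range N, (cauchyC (n + 1) : ℂ) * binomialDirichletSum n s with hFdef
  have hcd : ∀ n, ContDiff ℂ ⊤ fun s => (cauchyC (n + 1) : ℂ) * binomialDirichletSum n s :=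
    fun n => contDiff_const.mul (contDiff_binomialDirichletSum n)
  have hF : ∀ N, ContDiff ℂ ⊤ (F N) := fun N => ContDiff.sum fun n _ => hcd n
  obtain ⟨u, hu, hbd⟩ := summable_norm_bound_binomialDirichletSum
  have hlim : TendstoLocallyUniformlyOn F f atTop U :=
    (tendstoUniformlyOn_tsum_nat hu hbd).tendstoLocallyUniformlyOn
  have hfdiff : DifferentiableOn ℂ f U := hlim.differentiableOn
    (.of_forall fun N => ((hF N).differentiable (by simp)).differentiableOn) hU
  have hfg : Set.EqOn f (fun s => 1 - g s) U := by
    have hz : (5 / 4 : ℂ) ∈ U := by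
      rw [hUdef, Metric.mem_ball, dist_eq_norm]
      norm_num
    refine (hfdiff.analyticOnNhd hU).eqOn_of_preconnected_of_eventuallyEq
      (((differentiable_const 1).sub hg).differentiableOn.analyticOnNhd hU)
      (convex_ball _ _).isPreconnected hz ?_
    have hmem : {s : ℂ | 1 < s.re} ∈ nhds (5 / 4 : ℂ) :=
      (isOpen_lt continuous_const Complex.continuous_re).mem_nhds (by norm_num)
    filter_upwards [hmem] with s hs
    have hs1 : s ≠ 1 := by
      rintro rfl
      simp at hs
    change f s = 1 - g s
    rw [hgz s hs1]
    exact (hasSum_cauchyC_mul_binomialDirichletSum hs).tsum_eq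
  have hderiv : iteratedDeriv m f 1 = -iteratedDeriv m g 1 := by
    rw [(hfg.eventuallyEq_of_mem (hU.mem_nhds h1U)).iteratedDeriv_eq m,
      iteratedDeriv_const_sub (by lia), iteratedDeriv_neg]
  have ht := (tendstoLocallyUniformlyOn_iteratedDeriv hU hF hlim m).tendsto_at h1U
  have hsign : ((-1 : ℂ) ^ m) * (-1) ^ m = 1 := by
    rw [← mul_pow]; simp
  refine ⟨(-1) ^ m * iteratedDeriv m f 1, ?_, by rw [hderiv]; ring⟩
  refine (ht.const_mul ((-1) ^ m)).congr fun N => ?_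
  rw [hFdef, iteratedDeriv_fun_sum fun n _ => ((hcd n).of_le le_top).contDiffAt, Finset.mul_sum]
  refine Finset.sum_congr rfl fun n _ => ?_
  rw [iteratedDeriv_const_mul_field, iteratedDeriv_binomialDirichletSum_one, mul_left_comm,
    ← mul_assoc ((-1 : ℂ) ^ m), hsign, one_mul]
end

section
/- Let m ≥ 1 be an integer, let a ≥ −1 be a real number, and let s, v be complex numbers with Re s > 1 and Re v > −a. Then Σ_{n=0}^∞ (n+v)^{−s} = (1/(m(s−1))) Σ_{n=0}^{m−1} (v+a+n)^{1−s} + (1/m) Σ_{n=0}^∞ (−1)^n N_{n+1,m}(a) Σ_{k=0}^n (−1)^k C(n,k) (k+v)^{−s}, the outer series on the right being convergent. -/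
open Filter Finset intervalIntegral

/-- The polynomials `N_{n,m}(a) = ∫_a^{a+m} x(x−1)(x−2)⋯(x−n+1)/n! dx`. -/
noncomputable def serN (n m : ℕ) (a : ℝ) : ℝ :=
  ∫ x in a..(a + (m : ℝ)), (∏ i ∈ Finset.range n, (x - (i : ℝ))) / (n.factorial : ℝ)

lemma norm_cpow_mul_exp_neg_mul (s w : ℂ) {t : ℝ} (ht : 0 < t) :
    ‖(t : ℂ) ^ (s - 1) * Complex.exp (-(w * t))‖ =
      t ^ (s.re - 1) * Real.exp (-(w.re * t)) := by
  rw [norm_mul, Complex.norm_cpow_eq_rpow_re_of_pos ht, Complex.norm_exp]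
  simp

open MeasureTheory in
lemma integrableOn_rpow_mul_exp_neg_mul_Ioi {r σ : ℝ} (hr : 0 < r) (hσ : 0 < σ) :
    IntegrableOn (fun t : ℝ => t ^ (r - 1) * Real.exp (-(σ * t))) (Set.Ioi 0) := by
  have := integrableOn_rpow_mul_exp_neg_mul_rpow (p := 1) (s := r - 1) (b := σ)
    (by linarith) one_pos hσ
  simpa using this

open MeasureTheory in
lemma aestronglyMeasurable_cpow_mul_exp_neg_mul (s w : ℂ) :
    AEStronglyMeasurable (fun t : ℝ => (t : ℂ) ^ (s - 1) * Complex.exp (-(w * t)))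
      (volume.restrict (Set.Ioi 0)) := by
  refine ContinuousOn.aestronglyMeasurable (fun t ht => ?_) measurableSet_Ioi
  have ht' : (0 : ℝ) < t := ht
  refine ContinuousAt.continuousWithinAt (ContinuousAt.mul ?_ (by fun_prop))
  exact Complex.continuousAt_ofReal_cpow_const _ _ (Or.inr ht'.ne')

open MeasureTheory in
lemma integrableOn_cpow_mul_exp_neg_mul_Ioi {s w : ℂ} (hs : 0 < s.re) (hw : 0 < w.re) :
    IntegrableOn (fun t : ℝ => (t : ℂ) ^ (s - 1) * Complex.exp (-(w * t))) (Set.Ioi 0) := by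
  refine Integrable.mono' (integrableOn_rpow_mul_exp_neg_mul_Ioi hs hw)
    (aestronglyMeasurable_cpow_mul_exp_neg_mul s w) ?_
  filter_upwards [ae_restrict_mem measurableSet_Ioi] with t ht
  exact (norm_cpow_mul_exp_neg_mul s w ht).le

open MeasureTheory in
lemma differentiableAt_integral_cpow_mul_exp_neg_mul {s w : ℂ} (hs : 0 < s.re) (hw : 0 < w.re) :
    DifferentiableAt ℂ
      (fun w : ℂ => ∫ t in Set.Ioi (0 : ℝ), (t : ℂ) ^ (s - 1) * Complex.exp (-(w * t))) w := by
  have hU : {z : ℂ | w.re / 2 < z.re} ∈ nhds w :=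
    (isOpen_lt continuous_const Complex.continuous_re).mem_nhds (by
      simp only [Set.mem_ofPred_eq]; linarith)
  refine (hasDerivAt_integral_of_dominated_loc_of_deriv_le
    (F' := fun z t => (t : ℂ) ^ (s - 1) * (Complex.exp (-(z * t)) * (-t)))
    (bound := fun t => t ^ (s.re + 1 - 1) * Real.exp (-(w.re / 2 * t)))
    hU (Eventually.of_forall fun z => aestronglyMeasurable_cpow_mul_exp_neg_mul s z)
    (integrableOn_cpow_mul_exp_neg_mul_Ioi hs hw) ?_ ?_
    (integrableOn_rpow_mul_exp_neg_mul_Ioi (by linarith) (by linarith)) ?_).2.differentiableAt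
  · have h := (aestronglyMeasurable_cpow_mul_exp_neg_mul s w).mul
      (Continuous.aestronglyMeasurable (f := fun t : ℝ => (-(t : ℂ))) (by fun_prop))
    refine h.congr (Eventually.of_forall fun t => ?_)
    simp [mul_assoc]
  · filter_upwards [ae_restrict_mem measurableSet_Ioi] with t ht z hz
    have ht' : (0 : ℝ) < t := ht
    rw [← mul_assoc, norm_mul, norm_cpow_mul_exp_neg_mul s z ht, norm_neg, Complex.norm_real,
      Real.norm_of_nonneg ht'.le, mul_right_comm,
      show s.re + 1 - 1 = (s.re - 1) + 1 by ring, Real.rpow_add_one ht'.ne']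
    have : w.re / 2 * t ≤ z.re * t := mul_le_mul_of_nonneg_right (le_of_lt hz) ht'.le
    gcongr
  · refine Eventually.of_forall fun t z _ => ?_
    refine HasDerivAt.const_mul _ (HasDerivAt.cexp ?_)
    simpa using ((hasDerivAt_id z).mul_const (t : ℂ)).fun_neg

open MeasureTheory in
lemma integral_cpow_mul_exp_neg_complex_mul_Ioi {s w : ℂ} (hs : 0 < s.re) (hw : 0 < w.re) :
    ∫ t in Set.Ioi (0 : ℝ), (t : ℂ) ^ (s - 1) * Complex.exp (-(w * t)) =
      w ^ (-s) * Complex.Gamma s := by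
  have hopen : IsOpen {z : ℂ | 0 < z.re} := isOpen_lt continuous_const Complex.continuous_re
  have hf : AnalyticOnNhd ℂ (fun w : ℂ => ∫ t in Set.Ioi (0 : ℝ),
      (t : ℂ) ^ (s - 1) * Complex.exp (-(w * t))) {z : ℂ | 0 < z.re} :=
    DifferentiableOn.analyticOnNhd (fun z hz =>
      (differentiableAt_integral_cpow_mul_exp_neg_mul hs hz).differentiableWithinAt) hopen
  have hg : AnalyticOnNhd ℂ (fun w : ℂ => w ^ (-s) * Complex.Gamma s) {z : ℂ | 0 < z.re} := by
    refine DifferentiableOn.analyticOnNhd (fun z hz => ?_) hopen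
    refine DifferentiableAt.differentiableWithinAt ?_
    exact (differentiableAt_id.cpow_const (Or.inl hz)).mul_const _
  have hconn : IsPreconnected {z : ℂ | 0 < z.re} := (convex_halfSpace_re_gt 0).isPreconnected
  refine hf.eqOn_of_preconnected_of_frequently_eq hg hconn (z₀ := 1) (by simp) ?_ hw
  have htend : Tendsto (fun n : ℕ => (1 : ℂ) + (((1 / ((n : ℝ) + 1) : ℝ)) : ℂ)) atTop
      (nhdsWithin 1 {1}ᶜ) := by
    refine tendsto_nhdsWithin_iff.2 ⟨?_, Eventually.of_forall fun n => ?_⟩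
    · have := (Complex.continuous_ofReal.tendsto 0).comp
        (tendsto_one_div_add_atTop_nhds_zero_nat (𝕜 := ℝ))
      simpa using this.const_add (1 : ℂ)
    · simp only [Set.mem_compl_iff, Set.mem_singleton_iff, add_eq_left, Complex.ofReal_eq_zero]
      positivity
  refine htend.frequently (Frequently.of_forall fun n => ?_)
  have hr : (0 : ℝ) < 1 + 1 / ((n : ℝ) + 1) := by positivity
  have := Complex.integral_cpow_mul_exp_neg_mul_Ioi hs hr
  push_cast at this ⊢
  rw [this, one_div, Complex.inv_cpow, Complex.cpow_neg]
  have h := Complex.arg_ofReal_of_nonneg hr.le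
  push_cast at h
  rw [h]
  exact Real.pi_pos.ne

/-- The alternating binomial sum `∑ₖ (-1)ᵏ C(n,k) f k`, i.e. `(-1)ⁿ Δⁿ f 0`. -/
def altBinomSum (f : ℕ → ℂ) (n : ℕ) : ℂ :=
  ∑ k ∈ Finset.range (n + 1), (-1) ^ k * (n.choose k : ℂ) * f k

lemma altBinomSum_succ (f : ℕ → ℂ) (n : ℕ) :
    altBinomSum f (n + 1) = altBinomSum f n - altBinomSum (fun k => f (k + 1)) n := by
  have h : altBinomSum f n =
      ∑ k ∈ Finset.range (n + 2), (-1) ^ k * (n.choose k : ℂ) * f k := by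
    rw [Finset.sum_range_succ _ (n + 1)]
    simp [altBinomSum]
  rw [h, Finset.sum_range_succ', altBinomSum, altBinomSum, Finset.sum_range_succ',
    add_sub_right_comm, ← Finset.sum_sub_distrib]
  congr 1
  · refine Finset.sum_congr rfl fun k _ => ?_
    rw [Nat.choose_succ_succ]
    push_cast
    ring
  · simp

lemma altBinomSum_geom (c q : ℂ) (n : ℕ) :
    altBinomSum (fun k => c * q ^ k) n = c * (1 - q) ^ n := by
  rw [sub_eq_neg_add, add_pow, altBinomSum, Finset.mul_sum]
  refine Finset.sum_congr rfl fun k _ => ?_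
  rw [neg_pow, one_pow]
  ring

/-- The binomial coefficient `C(x,n)` as a polynomial in the real variable `x`. -/
noncomputable def realChoose (n : ℕ) (x : ℝ) : ℝ :=
  (∏ i ∈ Finset.range n, (x - (i : ℝ))) / (n.factorial : ℝ)

lemma continuous_realChoose (n : ℕ) : Continuous (realChoose n) := by
  unfold realChoose
  fun_prop

lemma realChoose_succ (n : ℕ) (x : ℝ) :
    realChoose (n + 1) x = realChoose n x * ((x - n) / (n + 1)) := by
  unfold realChoose
  rw [Finset.prod_range_succ, Nat.factorial_succ]
  push_cast
  rw [mul_comm ((n : ℝ) + 1), mul_div_mul_comm]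

lemma realChoose_eq_ringChoose (n : ℕ) (x : ℝ) : realChoose n x = Ring.choose x n := by
  have h := Ring.descPochhammer_eq_factorial_smul_choose x n
  rw [← Polynomial.aeval_eq_smeval, ← Polynomial.eval_map_algebraMap, descPochhammer_map,
    descPochhammer_eval_eq_prod_range] at h
  rw [realChoose, h, nsmul_eq_mul, mul_div_cancel_left₀]
  exact_mod_cast n.factorial_ne_zero

lemma realChoose_succ_add_one (n : ℕ) (x : ℝ) :
    realChoose (n + 1) (x + 1) = realChoose (n + 1) x + realChoose n x := by
  simp only [realChoose_eq_ringChoose]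
  rw [Ring.choose_succ_succ, add_comm]

lemma hasSum_realChoose_mul_pow (x : ℝ) {y : ℝ} (hy : |y| < 1) :
    HasSum (fun n => realChoose n x * y ^ n) ((1 + y) ^ x) := by
  have h := (Real.one_add_rpow_hasFPowerSeriesOnBall_zero (a := x)).hasSum (y := y) (by
    simpa [Metric.mem_eball, edist_zero_right, ← ofReal_norm, Real.norm_eq_abs] using hy)
  simp only [binomialSeries_apply, List.ofFn_const, List.prod_replicate, smul_eq_mul,
    zero_add] at h
  simpa only [realChoose_eq_ringChoose] using h

lemma serN_eq (n m : ℕ) (a : ℝ) : serN n m a = ∫ x in a..(a + (m : ℝ)), realChoose n x := rfl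

lemma serN_zero (m : ℕ) (a : ℝ) : serN 0 m a = m := by
  simp [serN]

lemma serN_succ (n m : ℕ) (a : ℝ) :
    serN (n + 1) m a = serN (n + 1) m (a - 1) + serN n m (a - 1) := by
  have h := intervalIntegral.integral_comp_add_right (a := a - 1) (b := a - 1 + m)
    (realChoose (n + 1)) 1
  rw [sub_add_cancel, show a - 1 + (m : ℝ) + 1 = a + m by ring] at h
  rw [serN_eq, serN_eq, serN_eq, ← h, ← intervalIntegral.integral_add
    ((continuous_realChoose _).intervalIntegrable _ _)
    ((continuous_realChoose _).intervalIntegrable _ _)]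
  simp only [realChoose_succ_add_one]

/-- `∫ₐ^{a+m} |C(x,n)| dx`, which dominates `|N_{n,m}(a)|`. -/
noncomputable def absSerN (n m : ℕ) (a : ℝ) : ℝ :=
  ∫ x in a..(a + (m : ℝ)), |realChoose n x|

lemma absSerN_nonneg (n m : ℕ) (a : ℝ) : 0 ≤ absSerN n m a :=
  intervalIntegral.integral_nonneg (by simp) fun _ _ => abs_nonneg _

lemma abs_serN_le (n m : ℕ) (a : ℝ) : |serN n m a| ≤ absSerN n m a :=
  intervalIntegral.abs_integral_le_integral_abs (by simp)

lemma absSerN_succ_le {n m : ℕ} {a : ℝ} (ha : -1 ≤ a) (hn : a + m ≤ n) :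
    absSerN (n + 1) m a * ((n : ℝ) + 2) ^ (a + 1) ≤ absSerN n m a * ((n : ℝ) + 1) ^ (a + 1) := by
  have hp : 0 ≤ a + 1 := by linarith
  have hn1 : (0 : ℝ) < n + 1 := by positivity
  have key : absSerN (n + 1) m a ≤
      absSerN n m a * (((n : ℝ) + 1) / (n + 2)) ^ (a + 1) := by
    unfold absSerN
    rw [← intervalIntegral.integral_mul_const]
    refine intervalIntegral.integral_mono_on (by simp)
      ((continuous_realChoose _).abs.intervalIntegrable _ _)
      (((continuous_realChoose _).abs.mul_const _).intervalIntegrable _ _) fun x hx => ?_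
    rw [realChoose_succ, abs_mul]
    refine mul_le_mul_of_nonneg_left ?_ (abs_nonneg _)
    rw [abs_of_nonpos (div_nonpos_of_nonpos_of_nonneg (by linarith [hx.2]) hn1.le)]
    have h1 : Real.exp (1 / (n + 1)) ≥ ((n : ℝ) + 2) / (n + 1) := by
      have := Real.add_one_le_exp (1 / ((n : ℝ) + 1))
      have h2 : ((n : ℝ) + 2) / (n + 1) = 1 / ((n : ℝ) + 1) + 1 := by field_simp; ring
      rw [h2]
      exact this
    have h3 : Real.exp (-(1 / (n + 1))) ≤ ((n : ℝ) + 1) / (n + 2) := by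
      rw [Real.exp_neg, ← inv_div ((n : ℝ) + 2)]
      exact inv_anti₀ (by positivity) h1
    calc -((x - n) / (n + 1)) ≤ -(a + 1) / (n + 1) + 1 := by
          rw [div_add_one hn1.ne', ← neg_div]
          gcongr
          linarith [hx.1]
      _ ≤ Real.exp (-(a + 1) / (n + 1)) := Real.add_one_le_exp _
      _ = Real.exp (-(1 / (n + 1))) ^ (a + 1) := by
          rw [← Real.exp_mul]
          congr 1
          ring
      _ ≤ _ := Real.rpow_le_rpow (Real.exp_pos _).le h3 hp
  rw [Real.div_rpow hn1.le (by positivity), mul_div_assoc', le_div_iff₀ (by positivity)] at key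
  exact key

lemma exists_absSerN_le {a : ℝ} (ha : -1 ≤ a) (m : ℕ) :
    ∃ C : ℝ, 0 ≤ C ∧ ∀ n : ℕ, absSerN n m a ≤ C * ((n : ℝ) + 1) ^ (-(a + 1)) := by
  obtain ⟨n₀, hn₀⟩ := exists_nat_ge (a + m)
  set u : ℕ → ℝ := fun n => absSerN n m a * ((n : ℝ) + 1) ^ (a + 1) with hu
  have hu0 : ∀ n, 0 ≤ u n := fun n => mul_nonneg (absSerN_nonneg _ _ _) (by positivity)
  have hanti : ∀ k, u (n₀ + k) ≤ u n₀ := by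
    intro k
    induction k with
    | zero => rfl
    | succ k ih =>
      refine le_trans ?_ ih
      have := absSerN_succ_le (n := n₀ + k) (m := m) ha (by push_cast; linarith)
      simp only [hu]
      have hcast : ((n₀ + (k + 1) : ℕ) : ℝ) + 1 = ((n₀ + k : ℕ) : ℝ) + 2 := by
        push_cast
        ring
      rw [hcast]
      exact this
  refine ⟨∑ n ∈ Finset.range (n₀ + 1), u n, Finset.sum_nonneg fun n _ => hu0 n, fun n => ?_⟩
  have hle : u n ≤ ∑ n ∈ Finset.range (n₀ + 1), u n := by
    rcases le_total n n₀ with h | h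
    · exact Finset.single_le_sum (fun n _ => hu0 n) (Finset.mem_range.2 (by omega))
    · obtain ⟨k, rfl⟩ := Nat.exists_eq_add_of_le h
      exact (hanti k).trans
        (Finset.single_le_sum (fun n _ => hu0 n) (Finset.mem_range.2 (by omega)))
  have hpos : (0 : ℝ) < (n : ℝ) + 1 := by positivity
  rw [Real.rpow_neg hpos.le, ← div_eq_mul_inv, le_div_iff₀ (by positivity)]
  exact hle

lemma integrableOn_cpow_mul_exp_mul_one_sub_exp_pow {s v : ℂ} (hs : 0 < s.re) (hv : 0 < v.re)
    (n : ℕ) : MeasureTheory.IntegrableOn (fun t : ℝ => (t : ℂ) ^ (s - 1) *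
      Complex.exp (-(v * t)) * (1 - Complex.exp (-t)) ^ n) (Set.Ioi 0) := by
  refine MeasureTheory.Integrable.mul_bdd (c := 1)
    (integrableOn_cpow_mul_exp_neg_mul_Ioi hs hv)
    (Continuous.aestronglyMeasurable (by fun_prop)) ?_
  filter_upwards [MeasureTheory.ae_restrict_mem measurableSet_Ioi] with t ht
  have ht' : (0 : ℝ) < t := ht
  rw [norm_pow]
  refine pow_le_one₀ (norm_nonneg _) ?_
  have h1 : Real.exp (-t) ≤ 1 := Real.exp_le_one_iff.2 (by linarith)
  have : (1 : ℂ) - Complex.exp (-t) = ((1 - Real.exp (-t) : ℝ) : ℂ) := by push_cast; rfl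
  rw [this, Complex.norm_real, Real.norm_of_nonneg (by linarith)]
  linarith [Real.exp_pos (-t)]

lemma integral_cpow_mul_exp_mul_one_sub_exp_pow {s v : ℂ} (hs : 0 < s.re) (hv : 0 < v.re)
    (n : ℕ) :
    ∫ t in Set.Ioi (0 : ℝ), (t : ℂ) ^ (s - 1) * Complex.exp (-(v * t)) *
        (1 - Complex.exp (-t)) ^ n =
      altBinomSum (fun k => ((k : ℂ) + v) ^ (-s)) n * Complex.Gamma s := by
  have hre : ∀ k : ℕ, 0 < ((k : ℂ) + v).re := fun k => by
    simp only [Complex.add_re, Complex.natCast_re]; positivity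
  have h : ∀ t : ℝ, (t : ℂ) ^ (s - 1) * Complex.exp (-(v * t)) * (1 - Complex.exp (-t)) ^ n =
      ∑ k ∈ Finset.range (n + 1), (-1) ^ k * (n.choose k : ℂ) *
        ((t : ℂ) ^ (s - 1) * Complex.exp (-(((k : ℂ) + v) * t))) := by
    intro t
    rw [← altBinomSum_geom, altBinomSum]
    refine Finset.sum_congr rfl fun k _ => ?_
    rw [← Complex.exp_nat_mul, mul_assoc, mul_assoc, mul_assoc, ← Complex.exp_add]
    congr 4
    ring_nf
  simp_rw [h]
  rw [MeasureTheory.integral_finsetSum _ fun k _ =>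
    (integrableOn_cpow_mul_exp_neg_mul_Ioi hs (hre k)).const_mul _]
  rw [altBinomSum, Finset.sum_mul]
  refine Finset.sum_congr rfl fun k _ => ?_
  rw [MeasureTheory.integral_const_mul,
    integral_cpow_mul_exp_neg_complex_mul_Ioi hs (hre k), ← mul_assoc]

lemma rpow_mul_exp_neg_le {c y : ℝ} (hc : 0 ≤ c) (hy : 0 ≤ y) :
    y ^ c * Real.exp (-y) ≤ (c + 1) ^ c := by
  have hc1 : 0 < c + 1 := by linarith
  have h1 : y ≤ (c + 1) * Real.exp (y / (c + 1)) := by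
    have := Real.add_one_le_exp (y / (c + 1))
    calc y = (c + 1) * (y / (c + 1)) := by field_simp
      _ ≤ _ := mul_le_mul_of_nonneg_left (by linarith) hc1.le
  rw [Real.exp_neg, ← div_eq_mul_inv, div_le_iff₀ (Real.exp_pos _)]
  calc y ^ c ≤ ((c + 1) * Real.exp (y / (c + 1))) ^ c := Real.rpow_le_rpow hy h1 hc
    _ = (c + 1) ^ c * Real.exp (y / (c + 1) * c) := by
      rw [Real.mul_rpow hc1.le (Real.exp_pos _).le, ← Real.exp_mul]
    _ ≤ _ := by
      gcongr
      rw [div_mul_eq_mul_div, div_le_iff₀ hc1]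
      nlinarith

lemma rpow_mul_one_sub_pow_le {c u : ℝ} (hc : 0 ≤ c) (hu : 0 < u) (hu1 : u ≤ 1) (n : ℕ) :
    u ^ c * (1 - u) ^ n ≤ Real.exp 1 * (c + 1) ^ c * ((n : ℝ) + 1) ^ (-c) := by
  have hn : (0 : ℝ) < n + 1 := by positivity
  have h := rpow_mul_exp_neg_le hc (y := ((n : ℝ) + 1) * u) (by positivity)
  rw [Real.mul_rpow hn.le hu.le] at h
  have h2 : (1 - u) ^ n ≤ Real.exp 1 * Real.exp (-(((n : ℝ) + 1) * u)) := by
    calc (1 - u) ^ n ≤ Real.exp (-u) ^ n :=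
          pow_le_pow_left₀ (by linarith) (by linarith [Real.add_one_le_exp (-u)]) n
      _ = Real.exp (n * -u) := (Real.exp_nat_mul _ _).symm
      _ ≤ Real.exp (1 + -(((n : ℝ) + 1) * u)) := Real.exp_le_exp.2 (by nlinarith)
      _ = _ := Real.exp_add _ _
  rw [Real.rpow_neg hn.le, ← div_eq_mul_inv, le_div_iff₀ (by positivity)]
  calc u ^ c * (1 - u) ^ n * ((n : ℝ) + 1) ^ c
      ≤ u ^ c * (Real.exp 1 * Real.exp (-(((n : ℝ) + 1) * u))) * ((n : ℝ) + 1) ^ c := by gcongr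
    _ = Real.exp 1 * (((n : ℝ) + 1) ^ c * u ^ c * Real.exp (-(((n : ℝ) + 1) * u))) := by ring
    _ ≤ _ := mul_le_mul_of_nonneg_left h (Real.exp_pos _).le

lemma exists_integral_norm_le {s v : ℂ} (hs : 0 < s.re) {c : ℝ} (hc : 0 ≤ c) (hcv : c < v.re) :
    ∃ C : ℝ, 0 ≤ C ∧ ∀ n : ℕ,
      ∫ t in Set.Ioi (0 : ℝ), ‖(t : ℂ) ^ (s - 1) * Complex.exp (-(v * t)) *
        (1 - Complex.exp (-t)) ^ n‖ ≤ C * ((n : ℝ) + 1) ^ (-c) := by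
  have hint := integrableOn_rpow_mul_exp_neg_mul_Ioi (r := s.re) (σ := v.re - c) hs (by linarith)
  refine ⟨Real.exp 1 * (c + 1) ^ c *
    ∫ t in Set.Ioi (0 : ℝ), t ^ (s.re - 1) * Real.exp (-((v.re - c) * t)), ?_, fun n => ?_⟩
  · refine mul_nonneg (by positivity)
      (MeasureTheory.setIntegral_nonneg measurableSet_Ioi fun t ht => ?_)
    exact mul_nonneg (Real.rpow_nonneg (le_of_lt ht) _) (Real.exp_pos _).le
  · rw [mul_right_comm, ← MeasureTheory.integral_const_mul]
    refine MeasureTheory.setIntegral_mono_on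
      (integrableOn_cpow_mul_exp_mul_one_sub_exp_pow hs (by linarith) n).norm
      (hint.const_mul _) measurableSet_Ioi fun t ht => ?_
    have ht' : (0 : ℝ) < t := ht
    have h1 : Real.exp (-t) ≤ 1 := Real.exp_le_one_iff.2 (by linarith)
    have : (1 : ℂ) - Complex.exp (-t) = ((1 - Real.exp (-t) : ℝ) : ℂ) := by push_cast; rfl
    rw [norm_mul, norm_cpow_mul_exp_neg_mul s v ht, norm_pow, this, Complex.norm_real,
      Real.norm_of_nonneg (by linarith)]
    have h2 := rpow_mul_one_sub_pow_le hc (Real.exp_pos (-t)) h1 n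
    rw [← Real.exp_mul] at h2
    have h3 : Real.exp (-(v.re * t)) = Real.exp (-((v.re - c) * t)) * Real.exp (-t * c) := by
      rw [← Real.exp_add]
      congr 1
      ring
    calc t ^ (s.re - 1) * Real.exp (-(v.re * t)) * (1 - Real.exp (-t)) ^ n
        = t ^ (s.re - 1) * Real.exp (-((v.re - c) * t)) *
            (Real.exp (-t * c) * (1 - Real.exp (-t)) ^ n) := by rw [h3]; ring
      _ ≤ t ^ (s.re - 1) * Real.exp (-((v.re - c) * t)) *
            (Real.exp 1 * (c + 1) ^ c * ((n : ℝ) + 1) ^ (-c)) := by gcongr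
      _ = _ := by ring

lemma hasSum_serN_mul_pow (m : ℕ) {a : ℝ} (ha : -1 ≤ a) {q : ℝ} (hq : 0 < q) (hq1 : q ≤ 1) :
    HasSum (fun n => serN n m a * (q - 1) ^ n) (∫ x in a..(a + (m : ℝ)), q ^ x) := by
  have hle : a ≤ a + m := by simp
  have hy : |q - 1| < 1 := by rw [abs_lt]; constructor <;> linarith
  obtain ⟨C, hC, hCb⟩ := exists_absSerN_le ha m
  have h := MeasureTheory.hasSum_integral_of_summable_integral_norm
    (F := fun (n : ℕ) (x : ℝ) => realChoose n x * (q - 1) ^ n)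
    (μ := MeasureTheory.volume.restrict (Set.Ioc a (a + m)))
    (fun n => (((continuous_realChoose n).mul_const _).intervalIntegrable a (a + m)).1) ?_
  · simp only [← intervalIntegral.integral_of_le hle, (hasSum_realChoose_mul_pow _ hy).tsum_eq,
      intervalIntegral.integral_mul_const, add_sub_cancel] at h
    exact h
  · simp only [← intervalIntegral.integral_of_le hle, norm_mul, norm_pow, Real.norm_eq_abs,
      intervalIntegral.integral_mul_const]
    refine Summable.of_nonneg_of_le
      (fun n => mul_nonneg (absSerN_nonneg n m a) (by positivity)) (fun n => ?_)
      ((summable_geometric_of_lt_one (abs_nonneg _) hy).mul_left C)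
    refine mul_le_mul_of_nonneg_right ((hCb n).trans ?_) (by positivity)
    refine mul_le_of_le_one_right hC (Real.rpow_le_one_of_one_le_of_nonpos ?_ (by linarith))
    have : (0 : ℝ) ≤ n := by positivity
    linarith

lemma hasSum_serN_succ_mul_pow (m : ℕ) {a : ℝ} (ha : -1 ≤ a) {t : ℝ} (ht : 0 < t) :
    HasSum (fun n => (-1) ^ n * serN (n + 1) m a * (1 - Real.exp (-t)) ^ n)
      ((m - Real.exp (-(a * t)) * (1 - Real.exp (-t) ^ m) / t) / (1 - Real.exp (-t))) := by
  have hq1 : Real.exp (-t) < 1 := by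
    rw [← Real.exp_zero]
    exact Real.exp_lt_exp.2 (by linarith)
  have hne : Real.exp (-t) - 1 ≠ 0 := by linarith
  have hne' : 1 - Real.exp (-t) ≠ 0 := by linarith
  have hI : ∫ x in a..(a + (m : ℝ)), Real.exp (-t) ^ x =
      Real.exp (-(a * t)) * (1 - Real.exp (-t) ^ m) / t := by
    simp only [← Real.exp_mul]
    rw [intervalIntegral.integral_comp_mul_left (fun x => Real.exp x) (by linarith : -t ≠ 0),
      integral_exp, ← Real.exp_nat_mul, mul_sub, mul_one, ← Real.exp_add, smul_eq_mul,
      show -(a * t) + m * -t = -t * (a + m) by ring, show -t * a = -(a * t) by ring]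
    field_simp
    ring
  have h := hasSum_serN_mul_pow m ha (Real.exp_pos (-t)) hq1.le
  rw [← hasSum_nat_add_iff' 1, hI] at h
  have h' := h.div_const (Real.exp (-t) - 1)
  have hval : (m - Real.exp (-(a * t)) * (1 - Real.exp (-t) ^ m) / t) / (1 - Real.exp (-t)) =
      (Real.exp (-(a * t)) * (1 - Real.exp (-t) ^ m) / t -
        ∑ i ∈ Finset.range 1, serN i m a * (Real.exp (-t) - 1) ^ i) / (Real.exp (-t) - 1) := by
    simp only [Finset.sum_range_one, serN_zero, pow_zero, mul_one]
    rw [show Real.exp (-t) - 1 = -(1 - Real.exp (-t)) by ring, div_neg, ← neg_div, neg_sub]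
  rw [hval]
  have hterm : (fun n => (-1) ^ n * serN (n + 1) m a * (1 - Real.exp (-t)) ^ n) =
      fun n => serN (n + 1) m a * (Real.exp (-t) - 1) ^ (n + 1) / (Real.exp (-t) - 1) := by
    funext n
    rw [pow_succ, ← mul_assoc, mul_div_cancel_right₀ _ hne,
      show Real.exp (-t) - 1 = -(1 - Real.exp (-t)) by ring, neg_pow (1 - Real.exp (-t)) n]
    ring
  rw [hterm]
  exact h'

/-- The general term of the Ser-type series for the parameters `s`, `v`, `m`, `a`. -/
noncomputable def serTerm (s v : ℂ) (m : ℕ) (a : ℝ) (n : ℕ) : ℂ :=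
  (-1) ^ n * (serN (n + 1) m a : ℂ) * altBinomSum (fun k => ((k : ℂ) + v) ^ (-s)) n

lemma summable_integral_norm_cpow_mul_exp {s v : ℂ} (hs : 1 < s.re) (hv : 0 < v.re) :
    Summable fun k : ℕ => ∫ t in Set.Ioi (0 : ℝ),
      ‖(t : ℂ) ^ (s - 1) * Complex.exp (-(((k : ℂ) + v) * t))‖ := by
  have h := (Real.summable_one_div_nat_add_rpow v.re s.re).2 hs
  refine (h.mul_right (Real.Gamma s.re)).congr fun k => ?_
  have hk : (0 : ℝ) < k + v.re := by positivity
  have hdiv : 1 / ((k : ℝ) + v.re) ^ s.re = (1 / ((k : ℝ) + v.re)) ^ s.re := by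
    rw [Real.div_rpow zero_le_one hk.le, Real.one_rpow]
  rw [abs_of_pos hk, hdiv, ← Real.integral_rpow_mul_exp_neg_mul_Ioi (by linarith) hk]
  refine MeasureTheory.setIntegral_congr_fun measurableSet_Ioi fun t ht => ?_
  simp only [norm_cpow_mul_exp_neg_mul s _ ht, Complex.add_re, Complex.natCast_re]

lemma hasSum_cpow_mul_exp {s v : ℂ} {t : ℝ} (ht : 0 < t) :
    HasSum (fun k : ℕ => (t : ℂ) ^ (s - 1) * Complex.exp (-(((k : ℂ) + v) * t)))
      ((t : ℂ) ^ (s - 1) * Complex.exp (-(v * t)) * (1 - Complex.exp (-t))⁻¹) := by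
  have hn : ‖Complex.exp (-t)‖ < 1 := by
    rw [Complex.norm_exp, ← Real.exp_zero]
    exact Real.exp_lt_exp.2 (by simpa using ht)
  have h := (hasSum_geometric_of_norm_lt_one hn).mul_left
    ((t : ℂ) ^ (s - 1) * Complex.exp (-(v * t)))
  have hterm : ∀ k : ℕ, (t : ℂ) ^ (s - 1) * Complex.exp (-(v * t)) * Complex.exp (-t) ^ k =
      (t : ℂ) ^ (s - 1) * Complex.exp (-(((k : ℂ) + v) * t)) := by
    intro k
    rw [← Complex.exp_nat_mul, mul_assoc, ← Complex.exp_add]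
    congr 2
    ring
  simpa only [hterm] using h

lemma sum_cpow_mul_exp {s v : ℂ} (m : ℕ) {t : ℝ} (ht : 0 < t) :
    ∑ j ∈ Finset.range m, (t : ℂ) ^ (s - 1 - 1) * Complex.exp (-((v + j) * t)) =
      (t : ℂ) ^ (s - 1) * Complex.exp (-(v * t)) *
        ((1 - Complex.exp (-t) ^ m) / t) * (1 - Complex.exp (-t))⁻¹ := by
  have ht0 : (t : ℂ) ≠ 0 := by exact_mod_cast ht.ne'
  have hn : Complex.exp (-t) ≠ 1 := by
    intro h
    have h1 : ‖Complex.exp (-t)‖ < 1 := by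
      rw [Complex.norm_exp, ← Real.exp_zero]
      exact Real.exp_lt_exp.2 (by simpa using ht)
    rw [h] at h1
    simp at h1
  have hterm : ∀ j : ℕ, (t : ℂ) ^ (s - 1 - 1) * Complex.exp (-((v + j) * t)) =
      (t : ℂ) ^ (s - 1 - 1) * Complex.exp (-(v * t)) * Complex.exp (-t) ^ j := by
    intro j
    rw [← Complex.exp_nat_mul, mul_assoc, ← Complex.exp_add]
    congr 2
    ring
  simp_rw [hterm]
  rw [← Finset.mul_sum, geom_sum_eq hn, Complex.cpow_sub _ _ ht0, Complex.cpow_one,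
    ← neg_sub 1 (Complex.exp (-t) ^ m), ← neg_sub 1 (Complex.exp (-t)), neg_div_neg_eq]
  ring

lemma summable_add_cpow_neg {s v : ℂ} (hs : 1 < s.re) (hv : 0 < v.re) :
    Summable fun k : ℕ => ((k : ℂ) + v) ^ (-s) := by
  have hs0 : 0 < s.re := by linarith
  have h : Summable fun k : ℕ => ((k : ℂ) + v) ^ (-s) * Complex.Gamma s := by
    refine Summable.of_norm_bounded (summable_integral_norm_cpow_mul_exp hs hv) fun k => ?_
    rw [← integral_cpow_mul_exp_neg_complex_mul_Ioi hs0
      (by simp only [Complex.add_re, Complex.natCast_re]; positivity)]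
    exact MeasureTheory.norm_integral_le_integral_norm _
  exact (summable_mul_right_iff (Complex.Gamma_ne_zero_of_re_pos hs0)).1 h

lemma integral_hurwitz_sub {s v : ℂ} (hs : 1 < s.re) (hv : 0 < v.re) (m : ℕ) {a : ℝ}
    (hva : -a < v.re) :
    ∫ t in Set.Ioi (0 : ℝ), (t : ℂ) ^ (s - 1) * Complex.exp (-(v * t)) *
        (((m - Real.exp (-(a * t)) * (1 - Real.exp (-t) ^ m) / t) / (1 - Real.exp (-t)) : ℝ) : ℂ) =
      (m * (∑' n : ℕ, ((n : ℂ) + v) ^ (-s)) -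
        1 / (s - 1) * ∑ n ∈ Finset.range m, (v + (a : ℂ) + (n : ℂ)) ^ (1 - s)) *
          Complex.Gamma s := by
  have hs0 : 0 < s.re := by linarith
  have hs1 : 0 < (s - 1).re := by simpa using hs
  have hre : ∀ k : ℕ, 0 < ((k : ℂ) + v).re := fun k => by
    simp only [Complex.add_re, Complex.natCast_re]; positivity
  have hrea : ∀ k : ℕ, 0 < (v + (a : ℂ) + (k : ℂ)).re := fun k => by
    simp only [Complex.add_re, Complex.natCast_re, Complex.ofReal_re]
    have : (0 : ℝ) ≤ k := by positivity
    linarith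
  set B : ℝ → ℂ := fun t => ∑ j ∈ Finset.range m,
    (t : ℂ) ^ (s - 1 - 1) * Complex.exp (-((v + (a : ℂ) + j) * t)) with hB
  have hBint : MeasureTheory.IntegrableOn B (Set.Ioi 0) :=
    MeasureTheory.integrable_finsetSum _ fun j _ =>
      integrableOn_cpow_mul_exp_neg_mul_Ioi hs1 (hrea j)
  have hBval : ∫ t in Set.Ioi (0 : ℝ), B t =
      1 / (s - 1) * (∑ n ∈ Finset.range m, (v + (a : ℂ) + (n : ℂ)) ^ (1 - s)) *
        Complex.Gamma s := by
    have hne : s - 1 ≠ 0 := fun h => by simp [h] at hs1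
    have hG := Complex.Gamma_add_one (s - 1) hne
    rw [sub_add_cancel] at hG
    rw [hB, MeasureTheory.integral_finsetSum _ fun j _ =>
      integrableOn_cpow_mul_exp_neg_mul_Ioi hs1 (hrea j)]
    simp_rw [fun j => integral_cpow_mul_exp_neg_complex_mul_Ioi hs1 (hrea j), neg_sub]
    rw [← Finset.sum_mul, hG]
    field_simp
  set H : ℕ → ℝ → ℂ := fun k t =>
    m * ((t : ℂ) ^ (s - 1) * Complex.exp (-(((k : ℂ) + v) * t))) - if k = 0 then B t else 0 with hH
  have hmint : ∀ k : ℕ, MeasureTheory.IntegrableOn (fun t : ℝ =>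
      (m : ℂ) * ((t : ℂ) ^ (s - 1) * Complex.exp (-(((k : ℂ) + v) * t)))) (Set.Ioi 0) := fun k =>
    (integrableOn_cpow_mul_exp_neg_mul_Ioi hs0 (hre k)).const_mul _
  have hiteint : ∀ k : ℕ, MeasureTheory.IntegrableOn (fun t : ℝ =>
      if k = 0 then B t else 0) (Set.Ioi 0) := fun k => by
    by_cases hk : k = 0
    · simpa [hk] using hBint
    · simp [hk]
  have hHval : ∀ k, ∫ t in Set.Ioi (0 : ℝ), H k t =
      m * (((k : ℂ) + v) ^ (-s) * Complex.Gamma s) -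
        if k = 0 then ∫ t in Set.Ioi (0 : ℝ), B t else 0 := by
    intro k
    rw [hH, MeasureTheory.integral_sub (hmint k) (hiteint k), MeasureTheory.integral_const_mul,
      integral_cpow_mul_exp_neg_complex_mul_Ioi hs0 (hre k)]
    by_cases hk : k = 0 <;> simp [hk]
  have hsum : Summable fun k => ∫ t in Set.Ioi (0 : ℝ), ‖H k t‖ := by
    rw [← summable_nat_add_iff 1]
    have h := ((summable_nat_add_iff 1).2
      (summable_integral_norm_cpow_mul_exp hs hv)).mul_left (m : ℝ)
    refine h.congr fun k => ?_
    rw [← MeasureTheory.integral_const_mul]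
    simp [hH]
  have h1 := MeasureTheory.hasSum_integral_of_summable_integral_norm
    (fun k => (hmint k).sub (hiteint k)) hsum
  have h2 : HasSum (fun k => ∫ t in Set.Ioi (0 : ℝ), H k t)
      (m * ((∑' n : ℕ, ((n : ℂ) + v) ^ (-s)) * Complex.Gamma s) -
        ∫ t in Set.Ioi (0 : ℝ), B t) := by
    simp_rw [hHval]
    exact (((summable_add_cpow_neg hs hv).hasSum.mul_right _).mul_left _).sub
      (hasSum_ite_eq 0 _)
  have h3 := h1.unique h2
  rw [hBval] at h3
  rw [sub_mul, mul_assoc (m : ℂ), ← h3]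
  refine MeasureTheory.setIntegral_congr_fun measurableSet_Ioi fun t ht => ?_
  have h4 : HasSum (fun k => H k t)
      (m * ((t : ℂ) ^ (s - 1) * Complex.exp (-(v * t)) * (1 - Complex.exp (-t))⁻¹) - B t) :=
    ((hasSum_cpow_mul_exp ht).mul_left _).sub (hasSum_ite_eq 0 _)
  refine Eq.trans ?_ h4.tsum_eq.symm
  simp only [hB]
  rw [sum_cpow_mul_exp m ht, add_mul, neg_add, Complex.exp_add]
  push_cast
  ring

lemma summable_norm_serN_mul {s v : ℂ} (hs : 0 < s.re) (hv : 0 < v.re) (m : ℕ) {a : ℝ}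
    (ha : -1 ≤ a) (hva : -a < v.re) :
    Summable fun n : ℕ => |serN (n + 1) m a| * ∫ t in Set.Ioi (0 : ℝ),
      ‖(t : ℂ) ^ (s - 1) * Complex.exp (-(v * t)) * (1 - Complex.exp (-t)) ^ n‖ := by
  set c := max 0 ((v.re - a) / 2) with hc
  have hc0 : 0 ≤ c := le_max_left _ _
  have hcv : c < v.re := max_lt hv (by linarith)
  have hca : 0 < a + c := by
    rcases le_or_gt a 0 with h | h
    · linarith [le_max_right 0 ((v.re - a) / 2)]
    · linarith
  obtain ⟨C, hC, hCb⟩ := exists_absSerN_le ha m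
  obtain ⟨C', hC', hCb'⟩ := exists_integral_norm_le hs hc0 hcv
  have hsum : Summable fun n : ℕ => ((n : ℝ) + 1) ^ (-(a + 1 + c)) := by
    have h := (Real.summable_one_div_nat_add_rpow 1 (a + 1 + c)).2 (by linarith)
    refine h.congr fun n => ?_
    have hn : (0 : ℝ) < n + 1 := by positivity
    rw [abs_of_pos hn, Real.rpow_neg hn.le, one_div]
  refine Summable.of_nonneg_of_le (fun n => mul_nonneg (abs_nonneg _)
    (MeasureTheory.integral_nonneg fun t => norm_nonneg _)) (fun n => ?_) (hsum.mul_left (C * C'))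
  have hn : (0 : ℝ) < n + 1 := by positivity
  have hN : |serN (n + 1) m a| ≤ C * ((n : ℝ) + 1) ^ (-(a + 1)) := by
    refine (abs_serN_le _ _ _).trans ((hCb (n + 1)).trans ?_)
    refine mul_le_mul_of_nonneg_left ?_ hC
    refine Real.rpow_le_rpow_of_nonpos hn (by push_cast; linarith) (by linarith)
  calc _ ≤ C * ((n : ℝ) + 1) ^ (-(a + 1)) * (C' * ((n : ℝ) + 1) ^ (-c)) :=
        mul_le_mul hN (hCb' n) (MeasureTheory.integral_nonneg fun t => norm_nonneg _)
          (by positivity)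
    _ = C * C' * (((n : ℝ) + 1) ^ (-(a + 1)) * ((n : ℝ) + 1) ^ (-c)) := by ring
    _ = _ := by
      rw [← Real.rpow_add hn]
      congr 2
      ring

lemma hasSum_serTerm_of_re_pos {s v : ℂ} (hs : 1 < s.re) (hv : 0 < v.re) (m : ℕ) {a : ℝ}
    (ha : -1 ≤ a) (hva : -a < v.re) :
    HasSum (serTerm s v m a) (m * (∑' n : ℕ, ((n : ℂ) + v) ^ (-s)) -
        1 / (s - 1) * ∑ n ∈ Finset.range m, (v + (a : ℂ) + (n : ℂ)) ^ (1 - s)) := by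
  have hs0 : 0 < s.re := by linarith
  have h := MeasureTheory.hasSum_integral_of_summable_integral_norm
    (F := fun (n : ℕ) (t : ℝ) => (-1) ^ n * (serN (n + 1) m a : ℂ) * ((t : ℂ) ^ (s - 1) *
      Complex.exp (-(v * t)) * (1 - Complex.exp (-t)) ^ n))
    (fun n => (integrableOn_cpow_mul_exp_mul_one_sub_exp_pow hs0 hv n).const_mul _) (by
      refine (summable_norm_serN_mul hs0 hv m ha hva).congr fun n => ?_
      rw [← MeasureTheory.integral_const_mul]
      refine MeasureTheory.integral_congr_ae (Eventually.of_forall fun t => ?_)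
      simp only [norm_mul ((-1) ^ n * (serN (n + 1) m a : ℂ)), norm_mul ((-1 : ℂ) ^ n), norm_pow,
        norm_neg, norm_one, one_pow, one_mul, Complex.norm_real, Real.norm_eq_abs])
  simp only [MeasureTheory.integral_const_mul,
    integral_cpow_mul_exp_mul_one_sub_exp_pow hs0 hv] at h
  rw [← hasSum_mul_right_iff (Complex.Gamma_ne_zero_of_re_pos hs0),
    ← integral_hurwitz_sub hs hv m hva]
  have hval : ∫ t in Set.Ioi (0 : ℝ), (t : ℂ) ^ (s - 1) * Complex.exp (-(v * t)) *
        (((m - Real.exp (-(a * t)) * (1 - Real.exp (-t) ^ m) / t) / (1 - Real.exp (-t)) : ℝ) : ℂ) =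
      ∫ t in Set.Ioi (0 : ℝ), ∑' n : ℕ, (-1) ^ n * (serN (n + 1) m a : ℂ) * ((t : ℂ) ^ (s - 1) *
        Complex.exp (-(v * t)) * (1 - Complex.exp (-t)) ^ n) := by
    refine MeasureTheory.setIntegral_congr_fun measurableSet_Ioi fun t ht => ?_
    have h2 := (Complex.hasSum_ofReal.2 (hasSum_serN_succ_mul_pow m ha ht)).mul_left
      ((t : ℂ) ^ (s - 1) * Complex.exp (-(v * t)))
    refine h2.tsum_eq.symm.trans (tsum_congr fun n => ?_)
    push_cast
    ring
  rw [hval]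
  simpa only [serTerm, mul_assoc] using h

lemma rpow_add_mul_rpow_sub_one_le {b : ℝ} (hb : 0 < b) (n : ℕ) :
    ((n : ℝ) + 1) ^ b + b / 2 * ((n : ℝ) + 1) ^ (b - 1) ≤ ((n : ℝ) + 2) ^ b := by
  have hn : (0 : ℝ) < n + 1 := by positivity
  have hn2 : (0 : ℝ) < n + 2 := by positivity
  set x : ℝ := ((n : ℝ) + 2) / (n + 1) with hx
  have hx0 : 0 < x := by positivity
  have hlog : 1 / (2 * ((n : ℝ) + 1)) ≤ Real.log x := by
    refine le_trans ?_ (Real.one_sub_inv_le_log_of_pos hx0)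
    rw [hx, inv_div, one_sub_div hn2.ne', show (n : ℝ) + 2 - (n + 1) = 1 by ring]
    exact one_div_le_one_div_of_le hn2 (by linarith [(n.cast_nonneg : (0 : ℝ) ≤ n)])
  have hpow : 1 + b * (1 / (2 * ((n : ℝ) + 1))) ≤ x ^ b := by
    rw [Real.rpow_def_of_pos hx0]
    have := Real.add_one_le_exp (Real.log x * b)
    nlinarith [mul_le_mul_of_nonneg_left hlog hb.le]
  calc ((n : ℝ) + 1) ^ b + b / 2 * ((n : ℝ) + 1) ^ (b - 1)
      = ((n : ℝ) + 1) ^ b * (1 + b * (1 / (2 * ((n : ℝ) + 1)))) := by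
        rw [Real.rpow_sub_one hn.ne']
        field_simp
    _ ≤ ((n : ℝ) + 1) ^ b * x ^ b := by gcongr
    _ = ((n : ℝ) + 2) ^ b := by
        rw [← Real.mul_rpow hn.le hx0.le, hx, mul_div_cancel₀ _ hn.ne']

lemma altBinomSum_shift (s v : ℂ) (n : ℕ) :
    altBinomSum (fun k => ((k : ℂ) + (v + 1)) ^ (-s)) n =
      altBinomSum (fun k => ((k : ℂ) + v) ^ (-s)) n -
        altBinomSum (fun k => ((k : ℂ) + v) ^ (-s)) (n + 1) := by
  rw [altBinomSum_succ, sub_sub_cancel]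
  congr 1
  funext k
  push_cast
  ring_nf

lemma exists_norm_altBinomSum_le_of_re_pos {s v : ℂ} (hs : 0 < s.re) (hv : 0 < v.re) {b : ℝ}
    (hb : -v.re < b) :
    ∃ C : ℝ, 0 ≤ C ∧ ∀ n : ℕ,
      ‖altBinomSum (fun k => ((k : ℂ) + v) ^ (-s)) n‖ ≤ C * ((n : ℝ) + 1) ^ b := by
  obtain ⟨C, hC, h⟩ := exists_integral_norm_le (v := v) hs (le_max_left 0 (-b))
    (max_lt hv (by linarith))
  have hG : 0 < ‖Complex.Gamma s‖ := norm_pos_iff.2 (Complex.Gamma_ne_zero_of_re_pos hs)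
  refine ⟨C / ‖Complex.Gamma s‖, by positivity, fun n => ?_⟩
  have hn : (1 : ℝ) ≤ n + 1 := by linarith [(n.cast_nonneg : (0 : ℝ) ≤ n)]
  rw [div_mul_eq_mul_div, le_div_iff₀ hG, ← norm_mul,
    ← integral_cpow_mul_exp_mul_one_sub_exp_pow hs hv]
  refine (MeasureTheory.norm_integral_le_integral_norm _).trans ((h n).trans ?_)
  refine mul_le_mul_of_nonneg_left (Real.rpow_le_rpow_of_exponent_le hn ?_) hC
  linarith [le_max_right 0 (-b)]

lemma exists_norm_altBinomSum_le {s : ℂ} (hs : 0 < s.re) (J : ℕ) :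
    ∀ v : ℂ, -(J : ℝ) < v.re → ∀ b : ℝ, -v.re < b → ∃ C : ℝ, 0 ≤ C ∧ ∀ n : ℕ,
      ‖altBinomSum (fun k => ((k : ℂ) + v) ^ (-s)) n‖ ≤ C * ((n : ℝ) + 1) ^ b := by
  induction J with
  | zero =>
    intro v hv b hb
    exact exists_norm_altBinomSum_le_of_re_pos hs (by simpa using hv) hb
  | succ J ih =>
    intro v hv b hb
    rcases lt_or_ge 0 v.re with hpos | hneg
    · exact exists_norm_altBinomSum_le_of_re_pos hs hpos hb
    have hb0 : 0 < b := by linarith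
    push_cast at hv
    obtain ⟨C, hC, h⟩ := ih (v + 1)
      (by rw [Complex.add_re, Complex.one_re]; linarith) (b - 1)
      (by rw [Complex.add_re, Complex.one_re]; linarith)
    set D : ℕ → ℂ := altBinomSum (fun k => ((k : ℂ) + v) ^ (-s)) with hD
    refine ⟨‖D 0‖ + 2 * C / b, by positivity, fun n => ?_⟩
    induction n with
    | zero =>
      simp only [Nat.cast_zero, zero_add, Real.one_rpow, mul_one]
      linarith [show 0 ≤ 2 * C / b by positivity]
    | succ n ihn =>
      have hDn : D (n + 1) = D n - altBinomSum (fun k => ((k : ℂ) + (v + 1)) ^ (-s)) n := by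
        rw [altBinomSum_shift, sub_sub_cancel]
      have hgrow := rpow_add_mul_rpow_sub_one_le hb0 n
      have hcast : ((n + 1 : ℕ) : ℝ) + 1 = n + 2 := by push_cast; ring
      have hK : C ≤ (‖D 0‖ + 2 * C / b) * (b / 2) := by
        have : (‖D 0‖ + 2 * C / b) * (b / 2) = ‖D 0‖ * (b / 2) + C := by field_simp
        rw [this]
        linarith [show 0 ≤ ‖D 0‖ * (b / 2) by positivity]
      rw [hDn, hcast]
      calc _ ≤ (‖D 0‖ + 2 * C / b) * ((n : ℝ) + 1) ^ b + C * ((n : ℝ) + 1) ^ (b - 1) :=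
            (norm_sub_le _ _).trans (add_le_add ihn (h n))
        _ ≤ (‖D 0‖ + 2 * C / b) * ((n : ℝ) + 1) ^ b +
            (‖D 0‖ + 2 * C / b) * (b / 2) * ((n : ℝ) + 1) ^ (b - 1) := by gcongr
        _ = (‖D 0‖ + 2 * C / b) *
            (((n : ℝ) + 1) ^ b + b / 2 * ((n : ℝ) + 1) ^ (b - 1)) := by ring
        _ ≤ _ := by gcongr

lemma tendsto_serN_mul_altBinomSum {s v : ℂ} (hs : 0 < s.re) (m : ℕ) {a : ℝ} (ha : 0 ≤ a)
    (hva : -a < v.re) :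
    Tendsto (fun n : ℕ => (-1) ^ n * (serN n m (a - 1) : ℂ) *
      altBinomSum (fun k => ((k : ℂ) + v) ^ (-s)) n) atTop (nhds 0) := by
  obtain ⟨J, hJ⟩ := exists_nat_gt (-v.re)
  obtain ⟨C, hC, h⟩ := exists_norm_altBinomSum_le hs J v (by linarith) ((a - v.re) / 2)
    (by linarith)
  obtain ⟨C', hC', h'⟩ := exists_absSerN_le (a := a - 1) (by linarith) m
  have hlim : Tendsto (fun n : ℕ => C' * C * ((n : ℝ) + 1) ^ (-((a + v.re) / 2)))
      atTop (nhds 0) := by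
    have h1 : Tendsto (fun n : ℕ => (n : ℝ) + 1) atTop atTop :=
      tendsto_atTop_add_const_right _ _ tendsto_natCast_atTop_atTop
    simpa using ((tendsto_rpow_neg_atTop
      (show 0 < (a + v.re) / 2 by linarith)).comp h1).const_mul (C' * C)
  refine squeeze_zero_norm (fun n => ?_) hlim
  have hn : (0 : ℝ) < n + 1 := by positivity
  rw [norm_mul, norm_mul, norm_pow, norm_neg, norm_one, one_pow, one_mul, Complex.norm_real,
    Real.norm_eq_abs]
  calc _ ≤ C' * ((n : ℝ) + 1) ^ (-(a - 1 + 1)) * (C * ((n : ℝ) + 1) ^ ((a - v.re) / 2)) :=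
        mul_le_mul ((abs_serN_le _ _ _).trans (h' n)) (h n) (norm_nonneg _) (by positivity)
    _ = C' * C * (((n : ℝ) + 1) ^ (-(a - 1 + 1)) * ((n : ℝ) + 1) ^ ((a - v.re) / 2)) := by ring
    _ = _ := by
      rw [← Real.rpow_add hn]
      congr 2
      ring

lemma sum_serTerm_shift (s v : ℂ) (m : ℕ) (a : ℝ) (N : ℕ) :
    ∑ n ∈ Finset.range N, serTerm s v m a n =
      ∑ n ∈ Finset.range N, serTerm s (v + 1) m (a - 1) n + (m * v ^ (-s) -
        (-1) ^ N * (serN N m (a - 1) : ℂ) * altBinomSum (fun k => ((k : ℂ) + v) ^ (-s)) N) := by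
  induction N with
  | zero => simp [serN_zero, altBinomSum]
  | succ N ih =>
    rw [Finset.sum_range_succ, Finset.sum_range_succ, ih, serTerm, serTerm, altBinomSum_shift,
      serN_succ N m a]
    push_cast
    ring

lemma summable_and_tendsto_sum_serTerm {s : ℂ} (hs : 1 < s.re) (m J : ℕ) :
    ∀ (v : ℂ) (a : ℝ), -1 ≤ a → -a < v.re → -(J : ℝ) < v.re →
      (Summable fun n : ℕ => ((n : ℂ) + v) ^ (-s)) ∧
      Tendsto (fun N => ∑ n ∈ Finset.range N, serTerm s v m a n) atTop
        (nhds (m * (∑' n : ℕ, ((n : ℂ) + v) ^ (-s)) -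
          1 / (s - 1) * ∑ n ∈ Finset.range m, (v + (a : ℂ) + (n : ℂ)) ^ (1 - s))) := by
  induction J with
  | zero =>
    intro v a ha hva hv
    have hv' : 0 < v.re := by simpa using hv
    exact ⟨summable_add_cpow_neg hs hv',
      (hasSum_serTerm_of_re_pos hs hv' m ha hva).tendsto_sum_nat⟩
  | succ J ih =>
    intro v a ha hva hv
    rcases lt_or_ge 0 v.re with hpos | hneg
    · exact ⟨summable_add_cpow_neg hs hpos,
        (hasSum_serTerm_of_re_pos hs hpos m ha hva).tendsto_sum_nat⟩
    push_cast at hv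
    obtain ⟨hsum, hlim⟩ := ih (v + 1) (a - 1) (by linarith)
      (by rw [Complex.add_re, Complex.one_re]; linarith)
      (by rw [Complex.add_re, Complex.one_re]; linarith)
    have hshift : (fun n : ℕ => (((n + 1 : ℕ) : ℂ) + v) ^ (-s)) =
        fun n : ℕ => ((n : ℂ) + (v + 1)) ^ (-s) := by
      funext n
      push_cast
      ring_nf
    have hsum' : Summable fun n : ℕ => ((n : ℂ) + v) ^ (-s) := by
      rw [← summable_nat_add_iff 1, hshift]
      exact hsum
    refine ⟨hsum', ?_⟩
    simp_rw [sum_serTerm_shift s v m a]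
    have h := hlim.add ((tendsto_const_nhds (x := (m : ℂ) * v ^ (-s))).sub
      (tendsto_serN_mul_altBinomSum (s := s) (by linarith) m (a := a) (by linarith) hva))
    convert h using 2
    rw [hsum'.tsum_eq_zero_add, hshift, Nat.cast_zero, zero_add,
      show v + 1 + ((a - 1 : ℝ) : ℂ) = v + a by push_cast; ring]
    ring

/-- Generalized Ser-type series for the Hurwitz zeta function: for integers `m ≥ 1`,
real `a ≥ −1` and complex `s, v` with `Re s > 1` and `Re v > −a`,
`Σ_{n=0}^∞ (n+v)^{−s} = (1/(m(s−1))) Σ_{n=0}^{m−1} (v+a+n)^{1−s}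
  + (1/m) Σ_{n=0}^∞ (−1)^n N_{n+1,m}(a) Σ_{k=0}^n (−1)^k C(n,k) (k+v)^{−s}`,
the outer infinite series being convergent. -/
theorem hurwitz_serN_series (m : ℕ) (hm : 1 ≤ m) (a : ℝ) (ha : -1 ≤ a)
    (s v : ℂ) (hs : 1 < s.re) (hv : -a < v.re) :
    ∃ L : ℂ,
      Tendsto (fun N : ℕ => ∑ n ∈ Finset.range N,
          (-1) ^ n * (Complex.ofReal (serN (n + 1) m a)) *
          ∑ k ∈ Finset.range (n + 1), (-1) ^ k * (n.choose k : ℂ) * ((k : ℂ) + v) ^ (-s))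
        atTop (nhds L) ∧
      (∑' n : ℕ, ((n : ℂ) + v) ^ (-s)) =
        (1 / ((m : ℂ) * (s - 1))) * ∑ n ∈ Finset.range m, (v + (a : ℂ) + (n : ℂ)) ^ (1 - s)
          + (1 / (m : ℂ)) * L := by

  obtain ⟨J, hJ⟩ := exists_nat_gt (-v.re)
  refine ⟨_, (summable_and_tendsto_sum_serTerm hs m J v a ha hv (by linarith)).2, ?_⟩
  have hm0 : (m : ℂ) ≠ 0 := by exact_mod_cast (by omega : m ≠ 0)
  have hs0 : s - 1 ≠ 0 := fun h => by
    have := congrArg Complex.re h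
    simp only [Complex.sub_re, Complex.one_re, Complex.zero_re] at this
    linarith
  field_simp
  ring
end
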